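/- Assume 5 < p < ∞ and let γ > 0. Then d_{𝕊²} > 0; that is, there exists a constant c > 0 such that every nonzero N-tuple u = (u_1,…,u_N) of C¹ functions on 𝕊², each antisymmetric about the equator, with Q**(u) = 0 satisfies M(u)^γ + E(u) ≥ c. -/

import Mathlib

open MeasureTheory Finset
open scoped RealInnerProductSpace

noncomputable section

abbrev E3 := EuclideanSpace ℝ (Fin 3)

/-- The unit sphere `𝕊² ⊆ ℝ³`. -/
def S2 : Set E3 := Metric.sphere (0 : E3) 1

/-- Reflection across the equatorial plane `{x₃ = 0}`. -/
def negz (x : E3) : E3 := (WithLp.equiv 2 (Fin 3 → ℝ)).symm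
  (fun i => if i = 2 then -(x i) else x i)

/-- `φ` is antisymmetric about the equator of `𝕊²`. -/
def Antisym (φ : E3 → ℂ) : Prop := ∀ x ∈ S2, φ (negz x) = -φ x

/-- Orthogonal projection of `v` onto the tangent plane of the unit sphere at `x`. -/
def tangProj (x v : E3) : E3 := v - ⟪x, v⟫ • x

/-- `|∇_{𝕊²}φ|²(x)`: the squared norm of the tangential (intrinsic) gradient of `φ` at `x`,
computed from the ambient derivative of a `C¹` extension. -/
def tGradSq (φ : E3 → ℂ) (x : E3) : ℝ :=
  ∑ i : Fin 3, ‖fderiv ℝ φ x (tangProj x (EuclideanSpace.single i (1 : ℝ)))‖ ^ 2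

/-- `M(u)` on the sphere. -/
def MS (N : ℕ) (u : Fin N → E3 → ℂ) : ℝ :=
  Real.sqrt (∑ j, ∫ x in S2, ‖u j x‖ ^ 2 ∂μH[2])

/-- `‖∇_{𝕊²}u‖₂²` on the sphere. -/
def gradS (N : ℕ) (u : Fin N → E3 → ℂ) : ℝ :=
  ∑ j, ∫ x in S2, tGradSq (u j) x ∂μH[2]

/-- The functional `𝒫(u)` on the sphere. -/
def PS (N : ℕ) (p : ℝ) (μ : Fin N → ℝ) (β : Fin N → Fin N → ℝ)
    (u : Fin N → E3 → ℂ) : ℝ :=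
  (∑ j, μ j * ∫ x in S2, ‖u j x‖ ^ (p + 1) ∂μH[2]) +
    ∑ i, ∑ j, (if i ≠ j then
      β i j * ∫ x in S2, ‖u i x‖ ^ ((p + 1) / 2) * ‖u j x‖ ^ ((p + 1) / 2) ∂μH[2] else 0)

/-- The energy `E(u)` on the sphere. -/
def ES (N : ℕ) (p : ℝ) (μ : Fin N → ℝ) (β : Fin N → Fin N → ℝ)
    (u : Fin N → E3 → ℂ) : ℝ :=
  gradS N u / 2 - PS N p μ β u / (p + 1)

/-- The functional `Q**(u)` on the sphere. -/
def Qss (N : ℕ) (p : ℝ) (μ : Fin N → ℝ) (β : Fin N → Fin N → ℝ)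
    (u : Fin N → E3 → ℂ) : ℝ :=
  gradS N u / 2 - ((p - 1) / (4 * (p + 1))) * PS N p μ β u

open Set ENNReal
open scoped NNReal

/-- The closed unit disk in `ℝ × ℝ`. -/
def unitDisk : Set (ℝ × ℝ) := {z | z.1 ^ 2 + z.2 ^ 2 ≤ 1}

lemma isClosed_unitDisk : IsClosed unitDisk :=
  isClosed_le (by fun_prop) continuous_const

lemma isCompact_unitDisk : IsCompact unitDisk := by
  refine (isCompact_Icc (a := ((-1, -1) : ℝ × ℝ)) (b := (1, 1))).of_isClosed_subset
    isClosed_unitDisk fun z hz => ?_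
  have hz : z.1 ^ 2 + z.2 ^ 2 ≤ 1 := hz
  refine ⟨⟨?_, ?_⟩, ⟨?_, ?_⟩⟩ <;> simp only <;> nlinarith [sq_nonneg z.1, sq_nonneg z.2]

lemma measurableSet_unitDisk : MeasurableSet unitDisk := isClosed_unitDisk.measurableSet

lemma enorm_le_lintegral_deriv_chord {g : ℝ → ℂ} (hg : ContDiff ℝ 1 g) {y : ℝ}
    (h0 : ∀ s : ℝ, s ^ 2 + y ^ 2 = 1 → g s = 0) {x : ℝ} (hx : x ^ 2 + y ^ 2 ≤ 1) :
    ‖g x‖ₑ ≤ ∫⁻ s in {s : ℝ | s ^ 2 + y ^ 2 ≤ 1}, ‖deriv g s‖ₑ := by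
  have hr : 0 ≤ 1 - y ^ 2 := by nlinarith [sq_nonneg x]
  have habs := Real.abs_le_sqrt (show x ^ 2 ≤ 1 - y ^ 2 by linarith)
  have h := enorm_sub_le_lintegral_deriv_of_contDiffOn_Icc (f := g) hg.contDiffOn
    (neg_le_of_abs_le habs)
  rw [h0 (-√(1 - y ^ 2)) (by rw [neg_sq, Real.sq_sqrt hr]; ring), sub_zero] at h
  refine h.trans (lintegral_mono_set fun s hs => ?_)
  have hs2 : s ^ 2 ≤ 1 - y ^ 2 := by
    rw [← Real.sq_sqrt hr]
    exact sq_le_sq' hs.1 (hs.2.trans (le_of_abs_le habs))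
  simp only [mem_ofPred_eq]
  linarith

lemma lintegral_unitDisk_sq_le {F : ℝ × ℝ → ℂ} (hF : ContDiff ℝ 1 F)
    (h0 : ∀ z : ℝ × ℝ, z.1 ^ 2 + z.2 ^ 2 = 1 → F z = 0) :
    ∫⁻ z in unitDisk, ‖F z‖ₑ ^ 2 ≤ (∫⁻ z in unitDisk, ‖fderiv ℝ F z‖ₑ) ^ 2 := by
  set H : ℝ × ℝ → ℝ≥0∞ := unitDisk.indicator fun z => ‖fderiv ℝ F z‖ₑ with hH
  have hHm : Measurable H :=
    (hF.continuous_fderiv one_ne_zero).enorm.measurable.indicator measurableSet_unitDisk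
  have hdiff : Differentiable ℝ F := hF.differentiable one_ne_zero
  have hA : ∀ z ∈ unitDisk, ‖F z‖ₑ ≤ ∫⁻ s, H (s, z.2) := by
    rintro ⟨x, y⟩ hz
    have h := enorm_le_lintegral_deriv_chord (g := fun s => F (s, y)) (by fun_prop)
      (y := y) (fun s hs => h0 (s, y) hs) (x := x) hz
    rw [← lintegral_indicator
      (isClosed_le (by fun_prop) continuous_const).measurableSet] at h
    refine h.trans (lintegral_mono fun s => ?_)
    by_cases hs : s ^ 2 + y ^ 2 ≤ 1
    · rw [indicator_of_mem (by exact hs), hH, indicator_of_mem (by exact hs)]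
      have hd : HasDerivAt (fun s => F (s, y)) (fderiv ℝ F (s, y) (1, 0)) s :=
        (hdiff (s, y)).hasFDerivAt.comp_hasDerivAt s
          ((hasDerivAt_id s).prodMk (hasDerivAt_const s y))
      rw [hd.deriv]
      refine ((fderiv ℝ F (s, y)).le_opENorm _).trans_eq ?_
      simp [← ofReal_norm]
    · rw [indicator_of_notMem (by exact hs)]
      exact zero_le
  have hB : ∀ z ∈ unitDisk, ‖F z‖ₑ ≤ ∫⁻ t, H (z.1, t) := by
    rintro ⟨x, y⟩ hz
    have h := enorm_le_lintegral_deriv_chord (g := fun s => F (x, s)) (by fun_prop)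
      (y := x) (fun s hs => h0 (x, s) (by simp only; linarith)) (x := y)
      (by have : x ^ 2 + y ^ 2 ≤ 1 := hz; linarith)
    rw [← lintegral_indicator
      (isClosed_le (by fun_prop) continuous_const).measurableSet] at h
    refine h.trans (lintegral_mono fun s => ?_)
    by_cases hs : s ^ 2 + x ^ 2 ≤ 1
    · have hs' : (x, s) ∈ unitDisk := by
        change x ^ 2 + s ^ 2 ≤ 1
        linarith
      rw [indicator_of_mem (by exact hs), hH, indicator_of_mem hs']
      have hd : HasDerivAt (fun s => F (x, s)) (fderiv ℝ F (x, s) (0, 1)) s :=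
        (hdiff (x, s)).hasFDerivAt.comp_hasDerivAt s
          ((hasDerivAt_const s x).prodMk (hasDerivAt_id s))
      rw [hd.deriv]
      refine ((fderiv ℝ F (x, s)).le_opENorm _).trans_eq ?_
      simp [← ofReal_norm]
    · rw [indicator_of_notMem (by exact hs)]
      exact zero_le
  have hAi : ∫⁻ y, ∫⁻ s, H (s, y) = ∫⁻ z in unitDisk, ‖fderiv ℝ F z‖ₑ := by
    rw [← lintegral_indicator measurableSet_unitDisk, Measure.volume_eq_prod,
      lintegral_prod_symm _ hHm.aemeasurable]
  have hBi : ∫⁻ x, ∫⁻ t, H (x, t) = ∫⁻ z in unitDisk, ‖fderiv ℝ F z‖ₑ := by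
    rw [← lintegral_indicator measurableSet_unitDisk, Measure.volume_eq_prod,
      lintegral_prod _ hHm.aemeasurable]
  calc ∫⁻ z in unitDisk, ‖F z‖ₑ ^ 2
      ≤ ∫⁻ z in unitDisk, (∫⁻ t, H (z.1, t)) * ∫⁻ s, H (s, z.2) := by
        refine setLIntegral_mono' measurableSet_unitDisk fun z hz => ?_
        rw [sq]
        exact mul_le_mul' (hB z hz) (hA z hz)
    _ ≤ ∫⁻ z : ℝ × ℝ, (∫⁻ t, H (z.1, t)) * ∫⁻ s, H (s, z.2) := setLIntegral_le_lintegral _ _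
    _ = (∫⁻ z in unitDisk, ‖fderiv ℝ F z‖ₑ) ^ 2 := by
        rw [Measure.volume_eq_prod, lintegral_prod_mul (f := fun x => ∫⁻ t, H (x, t))
          (g := fun y => ∫⁻ s, H (s, y)) hHm.lintegral_prod_right'.aemeasurable
          hHm.lintegral_prod_left'.aemeasurable, ← Measure.volume_eq_prod, hAi, hBi, sq]

lemma sq_lintegral_mul_le {α : Type*} [MeasurableSpace α] (ν : Measure α) {f g : α → ℝ≥0∞}
    (hf : AEMeasurable f ν) (hg : AEMeasurable g ν) :
    (∫⁻ a, f a * g a ∂ν) ^ 2 ≤ (∫⁻ a, f a ^ 2 ∂ν) * ∫⁻ a, g a ^ 2 ∂ν := by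
  have h := ENNReal.lintegral_mul_le_Lp_mul_Lq ν Real.HolderConjugate.two_two hf hg
  have h2 := pow_le_pow_left' h 2
  simp only [Pi.mul_apply, mul_pow, ← ENNReal.rpow_natCast, ← ENNReal.rpow_mul] at h2
  norm_num at h2
  simpa using h2

lemma lintegral_unitDisk_pow_succ_le {f : ℝ × ℝ → ℂ} (hf : ContDiff ℝ 1 f)
    (h0 : ∀ z : ℝ × ℝ, z.1 ^ 2 + z.2 ^ 2 = 1 → f z = 0) (k : ℕ) :
    ∫⁻ z in unitDisk, ‖f z‖ₑ ^ (2 * (k + 1)) ≤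
      (k + 1) ^ 2 * (∫⁻ z in unitDisk, ‖f z‖ₑ ^ (2 * k)) *
        ∫⁻ z in unitDisk, ‖fderiv ℝ f z‖ₑ ^ 2 := by
  have h := lintegral_unitDisk_sq_le (F := fun z => f z ^ (k + 1)) (hf.pow _)
    fun z hz => by simp [h0 z hz]
  have hd : ∀ z, ‖fderiv ℝ (fun z => f z ^ (k + 1)) z‖ₑ =
      (k + 1) * (‖f z‖ₑ ^ k * ‖fderiv ℝ f z‖ₑ) := fun z => by
    have hk : ‖((k + 1 : ℕ) : ℂ)‖ₑ = ((k + 1 : ℕ) : ℝ≥0∞) := by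
      rw [← ofReal_norm, Complex.norm_natCast, ENNReal.ofReal_natCast]
    push_cast at hk
    rw [fderiv_fun_pow _ (hf.differentiable one_ne_zero z), enorm_smul]
    simp [nsmul_eq_mul, mul_assoc, hk]
  have hc := hf.continuous
  have hc' := hf.continuous_fderiv one_ne_zero
  calc ∫⁻ z in unitDisk, ‖f z‖ₑ ^ (2 * (k + 1))
      = ∫⁻ z in unitDisk, ‖f z ^ (k + 1)‖ₑ ^ 2 := by
        simp only [enorm_pow, ← pow_mul, mul_comm]
    _ ≤ _ := h
    _ = (k + 1) ^ 2 * (∫⁻ z in unitDisk, ‖f z‖ₑ ^ k * ‖fderiv ℝ f z‖ₑ) ^ 2 := by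
        simp only [hd]
        rw [lintegral_const_mul _ (by fun_prop), mul_pow]
    _ ≤ _ := by
        rw [mul_assoc]
        gcongr
        refine (sq_lintegral_mul_le _ (by fun_prop) (by fun_prop)).trans_eq ?_
        simp only [← pow_mul, mul_comm]

lemma exists_lintegral_unitDisk_pow_le (k : ℕ) : ∃ C : ℝ≥0, ∀ f : ℝ × ℝ → ℂ, ContDiff ℝ 1 f →
    (∀ z : ℝ × ℝ, z.1 ^ 2 + z.2 ^ 2 = 1 → f z = 0) →
    ∫⁻ z in unitDisk, ‖f z‖ₑ ^ (2 * k) ≤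
      C * (∫⁻ z in unitDisk, ‖fderiv ℝ f z‖ₑ ^ 2) ^ k := by
  induction k with
  | zero =>
    refine ⟨(volume unitDisk).toNNReal, fun f _ _ => ?_⟩
    simp [ENNReal.coe_toNNReal isCompact_unitDisk.measure_lt_top.ne]
  | succ k ih =>
    obtain ⟨C, hC⟩ := ih
    refine ⟨(k + 1) ^ 2 * C, fun f hf h0 => (lintegral_unitDisk_pow_succ_le hf h0 k).trans ?_⟩
    push_cast
    rw [pow_succ _ k, ← mul_assoc, mul_assoc _ (C : ℝ≥0∞)]
    gcongr
    exact hC f hf h0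

lemma mem_S2_iff (x : E3) : x ∈ S2 ↔ x 0 ^ 2 + x 1 ^ 2 + x 2 ^ 2 = 1 := by
  rw [S2, mem_sphere_zero_iff_norm, ← sq_eq_sq₀ (norm_nonneg x) zero_le_one,
    EuclideanSpace.real_norm_sq_eq, Fin.sum_univ_three, one_pow]

/-- The closed hemisphere `{ε x₃ ≥ 0}` of `𝕊²`. -/
def cap (ε : ℝ) : Set E3 := {x | x ∈ S2 ∧ 0 ≤ ε * x 2}

lemma isClosed_cap (ε : ℝ) : IsClosed (cap ε) :=
  Metric.isClosed_sphere.inter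
    (isClosed_le (f := fun _ : E3 => (0 : ℝ)) (g := fun x : E3 => ε * x 2) (by fun_prop)
      (by fun_prop))

lemma isCompact_cap (ε : ℝ) : IsCompact (cap ε) :=
  (isCompact_sphere (0 : E3) 1).of_isClosed_subset (isClosed_cap ε) fun _ hx => hx.1

lemma measurableSet_cap (ε : ℝ) : MeasurableSet (cap ε) := (isClosed_cap ε).measurableSet

/-- Inverse stereographic projection; for `ε = ±1` it maps the unit disk onto `cap ε`. -/
def stereoInv (ε : ℝ) (z : ℝ × ℝ) : E3 :=
  !₂[2 * z.1 / (1 + z.1 ^ 2 + z.2 ^ 2), 2 * z.2 / (1 + z.1 ^ 2 + z.2 ^ 2),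
    ε * (1 - z.1 ^ 2 - z.2 ^ 2) / (1 + z.1 ^ 2 + z.2 ^ 2)]

/-- Stereographic projection from the pole `(0, 0, -ε)`. -/
def stereoProj (ε : ℝ) (x : E3) : ℝ × ℝ := (x 0 / (1 + ε * x 2), x 1 / (1 + ε * x 2))

lemma contDiff_stereoInv (ε : ℝ) : ContDiff ℝ 1 (stereoInv ε) := by
  have h : ∀ z : ℝ × ℝ, 1 + z.1 ^ 2 + z.2 ^ 2 ≠ 0 := fun z => by positivity
  rw [contDiff_euclidean]
  intro i
  fin_cases i <;> simp only [stereoInv] <;> exact ContDiff.div (by fun_prop) (by fun_prop) h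

lemma stereoInv_mem_S2 {ε : ℝ} (hε : ε ^ 2 = 1) (z : ℝ × ℝ) : stereoInv ε z ∈ S2 := by
  have h : 1 + z.1 ^ 2 + z.2 ^ 2 ≠ 0 := by positivity
  rw [mem_S2_iff]
  simp only [stereoInv, PiLp.toLp_apply, Matrix.cons_val]
  field_simp
  rw [hε]
  ring

lemma stereoInv_mem_cap {ε : ℝ} (hε : ε ^ 2 = 1) {z : ℝ × ℝ} (hz : z ∈ unitDisk) :
    stereoInv ε z ∈ cap ε := by
  refine ⟨stereoInv_mem_S2 hε z, ?_⟩
  have hz : z.1 ^ 2 + z.2 ^ 2 ≤ 1 := hz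
  have h : ε * (ε * (1 - z.1 ^ 2 - z.2 ^ 2) / (1 + z.1 ^ 2 + z.2 ^ 2)) =
      (1 - z.1 ^ 2 - z.2 ^ 2) / (1 + z.1 ^ 2 + z.2 ^ 2) := by
    rw [← mul_div_assoc, ← mul_assoc, ← sq, hε, one_mul]
  simp only [stereoInv, PiLp.toLp_apply, Matrix.cons_val]
  rw [h]
  exact div_nonneg (by linarith) (by positivity)

lemma stereoProj_mem_unitDisk {ε : ℝ} {x : E3} (hx : x ∈ cap ε) :
    stereoProj ε x ∈ unitDisk := by
  obtain ⟨hS, h0⟩ := hx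
  rw [mem_S2_iff] at hS
  have h1 : 0 < 1 + ε * x 2 := by linarith
  change (x 0 / (1 + ε * x 2)) ^ 2 + (x 1 / (1 + ε * x 2)) ^ 2 ≤ 1
  rw [div_pow, div_pow, ← add_div, div_le_one (by positivity)]
  nlinarith [sq_nonneg (ε * x 2), sq_nonneg (x 2)]

lemma stereoInv_stereoProj {ε : ℝ} (hε : ε ^ 2 = 1) {x : E3} (hx : x ∈ cap ε) :
    stereoInv ε (stereoProj ε x) = x := by
  obtain ⟨hS, h0⟩ := hx
  rw [mem_S2_iff] at hS
  have h1 : 1 + ε * x 2 ≠ 0 := by linarith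
  have hw : (ε * x 2) ^ 2 = x 2 ^ 2 := by rw [mul_pow, hε, one_mul]
  have hd : 1 + (x 0 / (1 + ε * x 2)) ^ 2 + (x 1 / (1 + ε * x 2)) ^ 2 = 2 / (1 + ε * x 2) := by
    field_simp
    linear_combination hS + hw
  have hn : 1 - (x 0 / (1 + ε * x 2)) ^ 2 - (x 1 / (1 + ε * x 2)) ^ 2 =
      2 * (ε * x 2) / (1 + ε * x 2) := by
    field_simp
    linear_combination -hS - hw
  ext i
  fin_cases i <;> simp [stereoInv, stereoProj, hd, hn]
  · field_simp
  · field_simp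
  · field_simp
    rw [hε, one_mul]

lemma stereoProj_stereoInv {ε : ℝ} (hε : ε ^ 2 = 1) (z : ℝ × ℝ) :
    stereoProj ε (stereoInv ε z) = z := by
  have h : 1 + z.1 ^ 2 + z.2 ^ 2 ≠ 0 := by positivity
  have hd : 1 + ε * (ε * (1 - z.1 ^ 2 - z.2 ^ 2) / (1 + z.1 ^ 2 + z.2 ^ 2)) =
      2 / (1 + z.1 ^ 2 + z.2 ^ 2) := by
    field_simp
    rw [hε]
    ring
  ext <;> simp only [stereoInv, stereoProj, PiLp.toLp_apply, Matrix.cons_val] <;> rw [hd] <;>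
    field_simp

lemma exists_lipschitzOnWith_stereoInv (ε : ℝ) :
    ∃ K, LipschitzOnWith K (stereoInv ε) unitDisk :=
  LocallyLipschitzOn.exists_lipschitzOnWith_of_compact isCompact_unitDisk
    (contDiff_stereoInv ε).locallyLipschitz.locallyLipschitzOn

lemma exists_lipschitzOnWith_stereoProj (ε : ℝ) :
    ∃ K, LipschitzOnWith K (stereoProj ε) (cap ε) := by
  refine LocallyLipschitzOn.exists_lipschitzOnWith_of_compact (isCompact_cap ε) fun x hx => ?_
  have h1 : 1 + ε * x 2 ≠ 0 := by linarith [hx.2]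
  have hc : ContDiffAt ℝ 1 (stereoProj ε) x :=
    ContDiffAt.prodMk (ContDiffAt.div (by fun_prop) (by fun_prop) h1)
      (ContDiffAt.div (by fun_prop) (by fun_prop) h1)
  obtain ⟨K, t, ht, hK⟩ := hc.exists_lipschitzOnWith
  exact ⟨K, t, mem_nhdsWithin_of_mem_nhds ht, hK⟩

lemma exists_lintegral_cap_le {ε : ℝ} (hε : ε ^ 2 = 1) : ∃ K : ℝ≥0, ∀ g : E3 → ℝ≥0∞,
    Measurable g → ∫⁻ x in cap ε, g x ∂μH[2] ≤ K * ∫⁻ z in unitDisk, g (stereoInv ε z) := by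
  obtain ⟨K, hK⟩ := exists_lipschitzOnWith_stereoInv ε
  have hm : Measurable (stereoInv ε) := (contDiff_stereoInv ε).continuous.measurable
  refine ⟨K ^ (2 : ℝ), fun g hg => ?_⟩
  have hle : (μH[2] : Measure E3).restrict (cap ε) ≤
      ((K ^ (2 : ℝ) : ℝ≥0) : ℝ≥0∞) • (volume.restrict unitDisk).map (stereoInv ε) := by
    refine Measure.le_iff.2 fun A hA => ?_
    rw [Measure.restrict_apply hA, Measure.smul_apply, Measure.map_apply hm hA,
      Measure.restrict_apply (hm hA), ← hausdorffMeasure_prod_real, smul_eq_mul,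
      ENNReal.coe_rpow_of_nonneg _ zero_le_two]
    refine (measure_mono ?_).trans
      ((hK.mono inter_subset_right).hausdorffMeasure_image_le zero_le_two)
    rintro x ⟨hxA, hx⟩
    have hinv := stereoInv_stereoProj hε hx
    exact ⟨stereoProj ε x, ⟨by rwa [Set.mem_preimage, hinv], stereoProj_mem_unitDisk hx⟩, hinv⟩
  refine (lintegral_mono' hle le_rfl).trans_eq ?_
  rw [lintegral_smul_measure, lintegral_map hg hm, smul_eq_mul]

lemma exists_lintegral_unitDisk_comp_le {ε : ℝ} (hε : ε ^ 2 = 1) : ∃ K : ℝ≥0, ∀ g : E3 → ℝ≥0∞,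
    Measurable g → ∫⁻ z in unitDisk, g (stereoInv ε z) ≤ K * ∫⁻ x in cap ε, g x ∂μH[2] := by
  obtain ⟨K, hK⟩ := exists_lipschitzOnWith_stereoProj ε
  have hm : Measurable (stereoInv ε) := (contDiff_stereoInv ε).continuous.measurable
  refine ⟨K ^ (2 : ℝ), fun g hg => ?_⟩
  have hle : (volume.restrict unitDisk).map (stereoInv ε) ≤
      ((K ^ (2 : ℝ) : ℝ≥0) : ℝ≥0∞) • (μH[2] : Measure E3).restrict (cap ε) := by
    refine Measure.le_iff.2 fun A hA => ?_
    rw [Measure.smul_apply, Measure.restrict_apply hA, Measure.map_apply hm hA,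
      Measure.restrict_apply (hm hA), ← hausdorffMeasure_prod_real, smul_eq_mul,
      ENNReal.coe_rpow_of_nonneg _ zero_le_two]
    refine (measure_mono ?_).trans
      ((hK.mono inter_subset_right).hausdorffMeasure_image_le zero_le_two)
    rintro z ⟨hzA, hz⟩
    exact ⟨stereoInv ε z, ⟨hzA, stereoInv_mem_cap hε hz⟩, stereoProj_stereoInv hε z⟩
  rw [← lintegral_map hg hm]
  refine (lintegral_mono' hle le_rfl).trans_eq ?_
  rw [lintegral_smul_measure, smul_eq_mul]

lemma tangProj_of_inner_eq_zero {x v : E3} (h : ⟪x, v⟫ = 0) : tangProj x v = v := by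
  simp [tangProj, h]

/-- The tangential projection at `x` as a linear map. -/
def tangProjL (x : E3) : E3 →ₗ[ℝ] E3 where
  toFun := tangProj x
  map_add' v w := by simp only [tangProj, inner_add_right, add_smul]; abel
  map_smul' c v := by simp [tangProj, inner_smul_right, smul_sub, smul_smul]

lemma norm_fderiv_sq_le_tGradSq (φ : E3 → ℂ) {x v : E3} (h : ⟪x, v⟫ = 0) :
    ‖fderiv ℝ φ x v‖ ^ 2 ≤ ‖v‖ ^ 2 * tGradSq φ x := by
  have hv : v = ∑ i, v i • EuclideanSpace.single i (1 : ℝ) := by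
    ext j
    simp [Finset.sum_apply, Pi.single_apply]
  have hv' : v = ∑ i, v i • tangProj x (EuclideanSpace.single i (1 : ℝ)) := by
    conv_lhs => rw [← tangProj_of_inner_eq_zero h, hv]
    exact (map_sum (tangProjL x) _ _).trans
      (Finset.sum_congr rfl fun i _ => (tangProjL x).map_smul _ _)
  have hn : ‖fderiv ℝ φ x v‖ ≤
      ∑ i, |v i| * ‖fderiv ℝ φ x (tangProj x (EuclideanSpace.single i (1 : ℝ)))‖ := by
    conv_lhs => rw [hv', map_sum]
    refine (norm_sum_le _ _).trans_eq (Finset.sum_congr rfl fun i _ => ?_)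
    rw [map_smul, norm_smul, Real.norm_eq_abs]
  calc _ ≤ (∑ i, |v i| * ‖fderiv ℝ φ x (tangProj x (EuclideanSpace.single i (1 : ℝ)))‖) ^ 2 := by
        gcongr
    _ ≤ _ := Finset.sum_mul_sq_le_sq_mul_sq _ _ _
    _ = _ := by simp [EuclideanSpace.real_norm_sq_eq, tGradSq]

lemma tGradSq_nonneg (φ : E3 → ℂ) (x : E3) : 0 ≤ tGradSq φ x :=
  Finset.sum_nonneg fun _ _ => by positivity

lemma continuous_tGradSq {φ : E3 → ℂ} (hφ : ContDiff ℝ 1 φ) : Continuous (tGradSq φ) := by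
  have h := hφ.continuous_fderiv one_ne_zero
  unfold tGradSq tangProj
  fun_prop

lemma inner_stereoInv_fderiv {ε : ℝ} (hε : ε ^ 2 = 1) (z w : ℝ × ℝ) :
    ⟪stereoInv ε z, fderiv ℝ (stereoInv ε) z w⟫ = 0 := by
  have h1 := (((contDiff_stereoInv ε).differentiable one_ne_zero) z).hasFDerivAt.norm_sq
  have hc : (fun z => ‖stereoInv ε z‖ ^ 2) = fun _ => (1 : ℝ) := by
    funext y
    rw [mem_sphere_zero_iff_norm.1 (stereoInv_mem_S2 hε y), one_pow]
  rw [hc] at h1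
  have := congrArg (fun L => L w) (h1.unique (hasFDerivAt_const (1 : ℝ) z))
  simpa using this

lemma exists_enorm_fderiv_comp_stereoInv_le {ε : ℝ} (hε : ε ^ 2 = 1) :
    ∃ C : ℝ≥0, ∀ φ : E3 → ℂ, ContDiff ℝ 1 φ → ∀ z ∈ unitDisk,
      ‖fderiv ℝ (φ ∘ stereoInv ε) z‖ₑ ^ 2 ≤ C * ENNReal.ofReal (tGradSq φ (stereoInv ε z)) := by
  have hσ := contDiff_stereoInv ε
  obtain ⟨C, hC⟩ := isCompact_unitDisk.exists_bound_of_continuousOn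
    (hσ.continuous_fderiv one_ne_zero).continuousOn
  refine ⟨(C ^ 2).toNNReal, fun φ hφ z hz => ?_⟩
  have hC0 : 0 ≤ C := (norm_nonneg _).trans (hC z hz)
  have hT := tGradSq_nonneg φ (stereoInv ε z)
  have hle : ‖fderiv ℝ (φ ∘ stereoInv ε) z‖ ≤ C * √(tGradSq φ (stereoInv ε z)) := by
    refine ContinuousLinearMap.opNorm_le_bound _ (by positivity) fun w => ?_
    rw [fderiv_comp z (hφ.differentiable one_ne_zero _) (hσ.differentiable one_ne_zero _),
      ContinuousLinearMap.comp_apply]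
    have h1 := norm_fderiv_sq_le_tGradSq φ (inner_stereoInv_fderiv hε z w)
    have h2 : ‖fderiv ℝ (stereoInv ε) z w‖ ≤ C * ‖w‖ :=
      (ContinuousLinearMap.le_opNorm _ _).trans (by gcongr; exact hC z hz)
    refine abs_le_of_sq_le_sq' ?_ (by positivity) |>.2
    refine h1.trans ?_
    rw [mul_pow, mul_pow, Real.sq_sqrt hT, mul_right_comm, ← mul_pow]
    gcongr
  rw [← ofReal_norm, ← ENNReal.ofReal_pow (norm_nonneg _), ENNReal.ofNNReal_toNNReal,
    ← ENNReal.ofReal_mul (by positivity)]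
  refine ENNReal.ofReal_le_ofReal ?_
  calc _ ≤ (C * √(tGradSq φ (stereoInv ε z))) ^ 2 := by gcongr
    _ = _ := by rw [mul_pow, Real.sq_sqrt hT]

lemma stereoInv_apply_two_eq_zero {ε : ℝ} {z : ℝ × ℝ} (hz : z.1 ^ 2 + z.2 ^ 2 = 1) :
    stereoInv ε z 2 = 0 := by
  have h : 1 - z.1 ^ 2 - z.2 ^ 2 = 0 := by linarith
  simp [stereoInv, h]

lemma exists_lintegral_fderiv_comp_stereoInv_le {ε : ℝ} (hε : ε ^ 2 = 1) :
    ∃ C : ℝ≥0, ∀ φ : E3 → ℂ, ContDiff ℝ 1 φ →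
      ∫⁻ z in unitDisk, ‖fderiv ℝ (φ ∘ stereoInv ε) z‖ₑ ^ 2 ≤
        C * ∫⁻ x in S2, ENNReal.ofReal (tGradSq φ x) ∂μH[2] := by
  obtain ⟨C, hC⟩ := exists_enorm_fderiv_comp_stereoInv_le hε
  obtain ⟨K, hK⟩ := exists_lintegral_unitDisk_comp_le hε
  refine ⟨C * K, fun φ hφ => ?_⟩
  have hm : Measurable fun x => ENNReal.ofReal (tGradSq φ x) :=
    (continuous_tGradSq hφ).measurable.ennreal_ofReal
  calc _ ≤ ∫⁻ z in unitDisk, C * ENNReal.ofReal (tGradSq φ (stereoInv ε z)) :=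
        setLIntegral_mono' measurableSet_unitDisk fun z hz => hC φ hφ z hz
    _ = C * ∫⁻ z in unitDisk, ENNReal.ofReal (tGradSq φ (stereoInv ε z)) :=
        lintegral_const_mul _ (hm.comp (contDiff_stereoInv ε).continuous.measurable)
    _ ≤ C * (K * ∫⁻ x in cap ε, ENNReal.ofReal (tGradSq φ x) ∂μH[2]) := by
        gcongr
        exact hK _ hm
    _ ≤ _ := by
        rw [ENNReal.coe_mul, mul_assoc]
        gcongr
        exact fun x hx => hx.1

lemma exists_lintegral_cap_pow_le {ε : ℝ} (hε : ε ^ 2 = 1) (k : ℕ) :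
    ∃ C : ℝ≥0, ∀ φ : E3 → ℂ, ContDiff ℝ 1 φ → (∀ x ∈ S2, x 2 = 0 → φ x = 0) →
      ∫⁻ x in cap ε, ‖φ x‖ₑ ^ (2 * k) ∂μH[2] ≤
        C * (∫⁻ x in S2, ENNReal.ofReal (tGradSq φ x) ∂μH[2]) ^ k := by
  obtain ⟨K, hK⟩ := exists_lintegral_cap_le hε
  obtain ⟨C, hC⟩ := exists_lintegral_unitDisk_pow_le k
  obtain ⟨B, hB⟩ := exists_lintegral_fderiv_comp_stereoInv_le hε
  refine ⟨K * (C * B ^ k), fun φ hφ h0 => ?_⟩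
  have hc := hφ.continuous
  refine (hK _ (by fun_prop)).trans ?_
  push_cast
  rw [mul_assoc, mul_assoc, ← mul_pow]
  gcongr
  refine (hC (φ ∘ stereoInv ε) (hφ.comp (contDiff_stereoInv ε)) fun z hz =>
    h0 _ (stereoInv_mem_S2 hε z) (stereoInv_apply_two_eq_zero hz)).trans ?_
  gcongr
  exact hB φ hφ

lemma S2_subset_cap_union : S2 ⊆ cap 1 ∪ cap (-1) := fun x hx => by
  rcases le_total 0 (x 2) with h | h
  · exact Or.inl ⟨hx, by linarith⟩
  · exact Or.inr ⟨hx, by linarith⟩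

lemma exists_lintegral_S2_pow_le (k : ℕ) :
    ∃ C : ℝ≥0, ∀ φ : E3 → ℂ, ContDiff ℝ 1 φ → (∀ x ∈ S2, x 2 = 0 → φ x = 0) →
      ∫⁻ x in S2, ‖φ x‖ₑ ^ (2 * k) ∂μH[2] ≤
        C * (∫⁻ x in S2, ENNReal.ofReal (tGradSq φ x) ∂μH[2]) ^ k := by
  obtain ⟨C, hC⟩ := exists_lintegral_cap_pow_le (ε := 1) (by norm_num) k
  obtain ⟨C', hC'⟩ := exists_lintegral_cap_pow_le (ε := -1) (by norm_num) k
  refine ⟨C + C', fun φ hφ h0 => ?_⟩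
  calc _ ≤ ∫⁻ x in cap 1 ∪ cap (-1), ‖φ x‖ₑ ^ (2 * k) ∂μH[2] :=
        lintegral_mono_set S2_subset_cap_union
    _ ≤ _ := lintegral_union_le _ _ _
    _ ≤ _ := by
        rw [ENNReal.coe_add, add_mul]
        exact add_le_add (hC φ hφ h0) (hC' φ hφ h0)

lemma hausdorffMeasure_S2_lt_top : (μH[2] : Measure E3) S2 < ⊤ := by
  obtain ⟨C, hC⟩ := exists_lintegral_S2_pow_le 0
  have h := hC (fun _ => 0) contDiff_const fun _ _ _ => rfl
  simp only [mul_zero, pow_zero, lintegral_one, Measure.restrict_apply_univ, mul_one] at h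
  exact h.trans_lt ENNReal.coe_lt_top

lemma integrableOn_S2 {g : E3 → ℝ} (hg : Continuous g) : IntegrableOn g S2 μH[2] :=
  hg.continuousOn.integrableOn_of_subset_isCompact (isCompact_sphere _ _)
    Metric.isClosed_sphere.measurableSet subset_rfl hausdorffMeasure_S2_lt_top.ne

lemma exists_integral_S2_pow_le (k : ℕ) :
    ∃ C : ℝ, 0 ≤ C ∧ ∀ φ : E3 → ℂ, ContDiff ℝ 1 φ → (∀ x ∈ S2, x 2 = 0 → φ x = 0) →
      ∫ x in S2, ‖φ x‖ ^ (2 * k) ∂μH[2] ≤ C * (∫ x in S2, tGradSq φ x ∂μH[2]) ^ k := by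
  obtain ⟨C, hC⟩ := exists_lintegral_S2_pow_le k
  refine ⟨C, C.coe_nonneg, fun φ hφ h0 => ?_⟩
  have hc := hφ.continuous
  have hG : 0 ≤ ∫ x in S2, tGradSq φ x ∂μH[2] := integral_nonneg (tGradSq_nonneg φ)
  have h := hC φ hφ h0
  rw [← ofReal_integral_eq_lintegral_ofReal (integrableOn_S2 (continuous_tGradSq hφ))
    (.of_forall (tGradSq_nonneg φ))] at h
  have hl : ∫⁻ x in S2, ‖φ x‖ₑ ^ (2 * k) ∂μH[2] =
      ENNReal.ofReal (∫ x in S2, ‖φ x‖ ^ (2 * k) ∂μH[2]) := by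
    rw [ofReal_integral_eq_lintegral_ofReal (integrableOn_S2 (by fun_prop))
      (.of_forall fun x => by positivity)]
    simp only [ENNReal.ofReal_pow (norm_nonneg _), ofReal_norm]
  rw [hl, ← ENNReal.ofReal_pow hG, ← ENNReal.ofReal_coe_nnreal,
    ← ENNReal.ofReal_mul (NNReal.coe_nonneg C)] at h
  exact (ENNReal.ofReal_le_ofReal_iff (mul_nonneg C.coe_nonneg (pow_nonneg hG k))).1 h

lemma eqOn_cap_of_integral_tGradSq_eq_zero {ε : ℝ} (hε : ε ^ 2 = 1) {φ : E3 → ℂ}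
    (hφ : ContDiff ℝ 1 φ) (h0 : ∀ x ∈ S2, x 2 = 0 → φ x = 0)
    (hG : ∫ x in S2, tGradSq φ x ∂μH[2] = 0) : ∀ x ∈ cap ε, φ x = 0 := by
  set f := φ ∘ stereoInv ε with hf
  have hfc : ContDiff ℝ 1 f := hφ.comp (contDiff_stereoInv ε)
  have hb : ∀ z : ℝ × ℝ, z.1 ^ 2 + z.2 ^ 2 = 1 → f z = 0 := fun z hz =>
    h0 _ (stereoInv_mem_S2 hε z) (stereoInv_apply_two_eq_zero hz)
  obtain ⟨B, hB⟩ := exists_lintegral_fderiv_comp_stereoInv_le hε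
  obtain ⟨C, hC⟩ := exists_lintegral_unitDisk_pow_le 1
  have hD := hB φ hφ
  rw [← ofReal_integral_eq_lintegral_ofReal (integrableOn_S2 (continuous_tGradSq hφ))
    (.of_forall (tGradSq_nonneg φ)), hG, ENNReal.ofReal_zero, mul_zero, nonpos_iff_eq_zero] at hD
  have hI := hC f hfc hb
  rw [hD, pow_one, mul_zero, nonpos_iff_eq_zero,
    lintegral_eq_zero_iff (by have := hfc.continuous; fun_prop)] at hI
  have hopen : IsOpen {z : ℝ × ℝ | z.1 ^ 2 + z.2 ^ 2 < 1} :=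
    isOpen_lt (by fun_prop) continuous_const
  have hae : f =ᵐ[volume.restrict {z : ℝ × ℝ | z.1 ^ 2 + z.2 ^ 2 < 1}] fun _ => 0 := by
    refine ae_restrict_of_ae_restrict_of_subset (t := unitDisk) (fun z hz => ?_) ?_
    · have hz : z.1 ^ 2 + z.2 ^ 2 < 1 := hz
      exact hz.le
    · filter_upwards [hI] with z hz
      simpa using hz
  have heq := Measure.eqOn_open_of_ae_eq hae hopen hfc.continuous.continuousOn continuousOn_const
  intro x hx
  have hz : stereoProj ε x ∈ unitDisk := stereoProj_mem_unitDisk hx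
  have hval : f (stereoProj ε x) = 0 := by
    rcases lt_or_eq_of_le (show (stereoProj ε x).1 ^ 2 + (stereoProj ε x).2 ^ 2 ≤ 1 from hz) with h | h
    · exact heq h
    · exact hb _ h
  rwa [hf, Function.comp_apply, stereoInv_stereoProj hε hx] at hval

lemma eqOn_S2_of_integral_tGradSq_eq_zero {φ : E3 → ℂ} (hφ : ContDiff ℝ 1 φ)
    (h0 : ∀ x ∈ S2, x 2 = 0 → φ x = 0) (hG : ∫ x in S2, tGradSq φ x ∂μH[2] = 0) :
    ∀ x ∈ S2, φ x = 0 := fun x hx =>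
  (S2_subset_cap_union hx).elim
    (eqOn_cap_of_integral_tGradSq_eq_zero (by norm_num) hφ h0 hG x)
    (eqOn_cap_of_integral_tGradSq_eq_zero (by norm_num) hφ h0 hG x)

lemma Antisym.eq_zero_of_equator {φ : E3 → ℂ} (h : Antisym φ) {x : E3} (hx : x ∈ S2)
    (hx2 : x 2 = 0) : φ x = 0 := by
  have hn : negz x = x := by
    ext i
    by_cases hi : i = 2 <;> simp [negz, hi, hx2]
  have := h x hx
  rw [hn] at this
  exact self_eq_neg.1 this

lemma exists_integral_S2_rpow_le {q : ℝ} (hq : 4 ≤ q) :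
    ∃ C : ℝ, 0 ≤ C ∧ ∀ φ : E3 → ℂ, ContDiff ℝ 1 φ → (∀ x ∈ S2, x 2 = 0 → φ x = 0) →
      ∫ x in S2, tGradSq φ x ∂μH[2] ≤ 1 →
      ∫ x in S2, ‖φ x‖ ^ q ∂μH[2] ≤ C * (∫ x in S2, tGradSq φ x ∂μH[2]) ^ 2 := by
  obtain ⟨m, hm⟩ := exists_nat_ge q
  have hm2 : 2 ≤ m := by
    have : (4 : ℝ) ≤ m := hq.trans hm
    have : 4 ≤ m := by exact_mod_cast this
    omega
  obtain ⟨A, hA0, hA⟩ := exists_integral_S2_pow_le 2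
  obtain ⟨B, hB0, hB⟩ := exists_integral_S2_pow_le m
  refine ⟨A + B, add_nonneg hA0 hB0, fun φ hφ h0 h1 => ?_⟩
  have hc := hφ.continuous
  have hG : 0 ≤ ∫ x in S2, tGradSq φ x ∂μH[2] := integral_nonneg (tGradSq_nonneg φ)
  have hpt : ∀ x, ‖φ x‖ ^ q ≤ ‖φ x‖ ^ (2 * 2) + ‖φ x‖ ^ (2 * m) := fun x => by
    rcases le_total ‖φ x‖ 1 with h | h
    · have : ‖φ x‖ ^ q ≤ ‖φ x‖ ^ (2 * 2) := by
        rcases (norm_nonneg (φ x)).eq_or_lt with h' | h'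
        · rw [← h', Real.zero_rpow (by linarith)]
          simp
        · rw [← Real.rpow_natCast]
          exact Real.rpow_le_rpow_of_exponent_ge h' h (by norm_num; linarith)
      exact this.trans (le_add_of_nonneg_right (by positivity))
    · have : ‖φ x‖ ^ q ≤ ‖φ x‖ ^ (2 * m) := by
        rw [← Real.rpow_natCast]
        refine Real.rpow_le_rpow_of_exponent_le h ?_
        push_cast
        linarith
      exact this.trans (le_add_of_nonneg_left (by positivity))
  have hi : ∀ n : ℕ, IntegrableOn (fun x => ‖φ x‖ ^ n) S2 μH[2] := fun n =>
    integrableOn_S2 (by fun_prop)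
  calc ∫ x in S2, ‖φ x‖ ^ q ∂μH[2]
      ≤ ∫ x in S2, (‖φ x‖ ^ (2 * 2) + ‖φ x‖ ^ (2 * m)) ∂μH[2] :=
        integral_mono
          (integrableOn_S2 (hc.norm.rpow_const fun _ => Or.inr (by linarith)))
          (integrableOn_S2 (by fun_prop)) hpt
    _ = _ := integral_add (hi _) (hi _)
    _ ≤ A * (∫ x in S2, tGradSq φ x ∂μH[2]) ^ 2 + B * (∫ x in S2, tGradSq φ x ∂μH[2]) ^ 2 := by
        refine add_le_add (hA φ hφ h0) ((hB φ hφ h0).trans ?_)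
        gcongr ?_ * ?_
        exact pow_le_pow_of_le_one hG h1 hm2
    _ = _ := by ring

lemma integral_S2_rpow_mul_le {φ ψ : E3 → ℂ} (hφ : Continuous φ) (hψ : Continuous ψ) {q : ℝ}
    (hq : 0 < q) :
    ∫ x in S2, ‖φ x‖ ^ (q / 2) * ‖ψ x‖ ^ (q / 2) ∂μH[2] ≤
      (∫ x in S2, ‖φ x‖ ^ q ∂μH[2]) + ∫ x in S2, ‖ψ x‖ ^ q ∂μH[2] := by
  have hc : ∀ {χ : E3 → ℂ}, Continuous χ → ∀ {r : ℝ}, 0 < r → Continuous fun x => ‖χ x‖ ^ r :=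
    fun h _ hr => h.norm.rpow_const fun _ => Or.inr hr.le
  rw [← integral_add (integrableOn_S2 (hc hφ hq)) (integrableOn_S2 (hc hψ hq))]
  refine integral_mono
    (integrableOn_S2 ((hc hφ (half_pos hq)).mul (hc hψ (half_pos hq))))
    ((integrableOn_S2 (hc hφ hq)).add (integrableOn_S2 (hc hψ hq))) fun x => ?_
  have hs : ∀ t : ℝ, 0 ≤ t → t ^ q = (t ^ (q / 2)) ^ 2 := fun t ht => by
    rw [← Real.rpow_natCast, ← Real.rpow_mul ht]
    norm_num
  simp only [hs _ (norm_nonneg _)]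
  nlinarith [sq_nonneg (‖φ x‖ ^ (q / 2) - ‖ψ x‖ ^ (q / 2)), sq_nonneg (‖φ x‖ ^ (q / 2)),
    sq_nonneg (‖ψ x‖ ^ (q / 2))]

lemma gradS_nonneg (N : ℕ) (u : Fin N → E3 → ℂ) : 0 ≤ gradS N u :=
  Finset.sum_nonneg fun j _ => integral_nonneg (tGradSq_nonneg (u j))

lemma exists_PS_le {N : ℕ} {p : ℝ} (hp : 3 ≤ p) {μ : Fin N → ℝ} (β : Fin N → Fin N → ℝ)
    (hμ : ∀ j, 0 < μ j) :
    ∃ B : ℝ, 0 ≤ B ∧ ∀ u : Fin N → E3 → ℂ, (∀ j, ContDiff ℝ 1 (u j)) →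
      (∀ j, Antisym (u j)) → gradS N u ≤ 1 → PS N p μ β u ≤ B * gradS N u ^ 2 := by
  obtain ⟨C, hC0, hC⟩ := exists_integral_S2_rpow_le (q := p + 1) (by linarith)
  refine ⟨(∑ j, μ j * C) + ∑ i, ∑ j, |β i j| * (C + C), add_nonneg
    (Finset.sum_nonneg fun j _ => mul_nonneg (hμ j).le hC0)
    (Finset.sum_nonneg fun i _ => Finset.sum_nonneg fun j _ => by positivity),
    fun u hu ha h1 => ?_⟩
  have hg : ∀ j, 0 ≤ ∫ x in S2, tGradSq (u j) x ∂μH[2] := fun j =>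
    integral_nonneg (tGradSq_nonneg (u j))
  have hgle : ∀ j, ∫ x in S2, tGradSq (u j) x ∂μH[2] ≤ gradS N u := fun j =>
    Finset.single_le_sum (f := fun j => ∫ x in S2, tGradSq (u j) x ∂μH[2])
      (fun i _ => hg i) (Finset.mem_univ j)
  have hq : ∀ j, ∫ x in S2, ‖u j x‖ ^ (p + 1) ∂μH[2] ≤ C * gradS N u ^ 2 := fun j =>
    (hC (u j) (hu j) (fun x hx => (ha j).eq_zero_of_equator hx) ((hgle j).trans h1)).trans (by
      have := hg j
      have := hgle j
      gcongr)
  rw [PS, add_mul, Finset.sum_mul, Finset.sum_mul]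
  refine add_le_add (Finset.sum_le_sum fun j _ => ?_) (Finset.sum_le_sum fun i _ => ?_)
  · rw [mul_assoc]
    exact mul_le_mul_of_nonneg_left (hq j) (hμ j).le
  · rw [Finset.sum_mul]
    refine Finset.sum_le_sum fun j _ => ?_
    split_ifs
    · have hI : 0 ≤ ∫ x in S2, ‖u i x‖ ^ ((p + 1) / 2) * ‖u j x‖ ^ ((p + 1) / 2) ∂μH[2] :=
        integral_nonneg fun x => by positivity
      refine (mul_le_mul_of_nonneg_right (le_abs_self _) hI).trans ?_
      rw [mul_assoc]
      gcongr
      refine (integral_S2_rpow_mul_le (hu i).continuous (hu j).continuous (by linarith)).trans ?_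
      rw [add_mul]
      exact add_le_add (hq i) (hq j)
    · positivity

/-- For `p > 5` and `γ > 0`, the constrained infimum `d_{𝕊²}` is positive:
there is `c > 0` such that every nonzero `N`-tuple `u` of `C¹` functions on `𝕊²`, each
antisymmetric about the equator, with `Q**(u) = 0` satisfies `M(u)^γ + E(u) ≥ c`. -/
theorem dS2_pos (N : ℕ) (hN : 1 ≤ N) (p γ : ℝ) (hp : 5 < p) (hγ : 0 < γ)
    (μ : Fin N → ℝ) (β : Fin N → Fin N → ℝ)
    (hμ : ∀ j, 0 < μ j) (hβ : ∀ i j, β i j = β j i) :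
    ∃ c : ℝ, 0 < c ∧ ∀ u : Fin N → E3 → ℂ,
      (∀ j, ContDiff ℝ 1 (u j)) → (∀ j, Antisym (u j)) →
      (¬ ∀ j, ∀ x ∈ S2, u j x = 0) →
      Qss N p μ β u = 0 →
      c ≤ MS N u ^ γ + ES N p μ β u := by
  obtain ⟨B, hB0, hB⟩ := exists_PS_le (p := p) (by linarith) β hμ
  have hκ : 0 < (p - 5) / (2 * (p - 1)) := div_pos (by linarith) (by linarith)
  refine ⟨(p - 5) / (2 * (p - 1)) * (1 / (B + 1)), by positivity, fun u hu ha hne hQ => ?_⟩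
  have hp1 : p - 1 ≠ 0 := by linarith
  have hp2 : p + 1 ≠ 0 := by linarith
  have hP : PS N p μ β u = 2 * (p + 1) / (p - 1) * gradS N u := by
    rw [Qss] at hQ
    field_simp at hQ ⊢
    linarith
  have hE : ES N p μ β u = (p - 5) / (2 * (p - 1)) * gradS N u := by
    rw [ES, hP]
    field_simp
    ring
  have hGpos : 0 < gradS N u := by
    refine (gradS_nonneg N u).lt_of_ne fun h => hne fun j => ?_
    have hz := (Finset.sum_eq_zero_iff_of_nonneg
      fun j _ => integral_nonneg (tGradSq_nonneg (u j))).1 h.symm j (Finset.mem_univ j)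
    exact eqOn_S2_of_integral_tGradSq_eq_zero (hu j)
      (fun x hx => (ha j).eq_zero_of_equator hx) hz
  have hG : 1 / (B + 1) ≤ gradS N u := by
    rw [div_le_iff₀ (by positivity)]
    rcases le_total 1 (gradS N u) with h1 | h1
    · nlinarith
    · have h2 := hB u hu ha h1
      have h3 : gradS N u ≤ PS N p μ β u := by
        rw [hP]
        refine le_mul_of_one_le_left hGpos.le ?_
        rw [le_div_iff₀ (by linarith)]
        linarith
      have h4 : gradS N u * 1 ≤ gradS N u * (B * gradS N u) := by
        linarith [h3.trans h2, show gradS N u * (B * gradS N u) = B * gradS N u ^ 2 by ring]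
      linarith [le_of_mul_le_mul_left h4 hGpos]
  have hM : 0 ≤ MS N u ^ γ := Real.rpow_nonneg (Real.sqrt_nonneg _) γ
  rw [hE]
  exact (mul_le_mul_of_nonneg_left hG hκ.le).trans (le_add_of_nonneg_left hM)

end
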